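/- For every real k > 1 and every λ₀ ∈ (0,1) such that μ₁(λ₀, k) = 0, the partial derivative of μ₁ with respect to λ is strictly negative at (λ₀, k): ∂μ₁/∂λ(λ₀, k) < 0, where μ₁(λ,k) = (T(λ,k) − √(T(λ,k)² − 4D(λ,k)))/2 − 2. -/

import Mathlib

open Set Filter
open scoped Topology

noncomputable section

/-- `R(λ)² = (1 - λ²)/(-2 log λ)`. -/
def Rsq (l : ℝ) : ℝ := (1 - l^2)/(-2*Real.log l)

/-- `ω(λ,k) = -k log λ`. -/
def om (l k : ℝ) : ℝ := -(k * Real.log l)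

/-- The hyperbolic cotangent. -/
def cothR (x : ℝ) : ℝ := Real.cosh x / Real.sinh x

/-- `c^i_λ = R(λ)²/λ - λ`. -/
def cI (l : ℝ) : ℝ := Rsq l / l - l

/-- `c^o_λ = 1 - R(λ)²`. -/
def cO (l : ℝ) : ℝ := 1 - Rsq l

/-- The trace `T(λ,k) = R²(1/λ² - 1) k coth ω + 2 - R² - R²/λ²` of `M̃_{λ,k}`. -/
def Tfun (l k : ℝ) : ℝ :=
  Rsq l * (1/l^2 - 1) * k * cothR (om l k) + 2 - Rsq l - Rsq l/l^2

/-- The determinant `D(λ,k) = (R²/λ² - 1)(1 - R²)(k² - 1)` of `M̃_{λ,k}`. -/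
def Dfun (l k : ℝ) : ℝ := (Rsq l/l^2 - 1) * (1 - Rsq l) * (k^2 - 1)

/-- The smaller eigenvalue `μ₁(λ,k) = (T - √(T² - 4D))/2 - 2` of `M_{λ,k}`. -/
def mu1 (l k : ℝ) : ℝ :=
  (Tfun l k - Real.sqrt ((Tfun l k)^2 - 4*Dfun l k))/2 - 2

/-- The larger eigenvalue `μ₂(λ,k) = (T + √(T² - 4D))/2 - 2` of `M_{λ,k}`. -/
def mu2 (l k : ℝ) : ℝ :=
  (Tfun l k + Real.sqrt ((Tfun l k)^2 - 4*Dfun l k))/2 - 2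

/-- A function with positive derivative on `(0, ∞)` and nonnegative value at `0` is positive. -/
lemma pos_of_hasDerivAt_pos {f f' : ℝ → ℝ} (hf : ∀ x, HasDerivAt f (f' x) x) (h0 : 0 ≤ f 0)
    (hf' : ∀ x, 0 < x → 0 < f' x) {x : ℝ} (hx : 0 < x) : 0 < f x := by
  have hmono : StrictMonoOn f (Ici 0) := by
    refine strictMonoOn_of_deriv_pos (convex_Ici 0)
      (fun y _ => (hf y).continuousAt.continuousWithinAt) fun y hy => ?_
    rw [interior_Ici] at hy
    rw [(hf y).deriv]
    exact hf' y hy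
  exact h0.trans_lt (hmono self_mem_Ici hx.le hx)

/-- An odd combination of `sinh`, `cosh` at `y` and `2y` with polynomial coefficients. -/
def hypOdd (a b c d e g p q y : ℝ) : ℝ :=
  (a + b * y^2) * Real.sinh (2*y) + c * y * Real.cosh (2*y) + (d + e * y^2) * Real.sinh y
    + g * y * Real.cosh y + p * y + q * y^3

/-- An even combination of `sinh`, `cosh` at `y` and `2y` with polynomial coefficients. -/
def hypEven (a b c d e g p q y : ℝ) : ℝ :=
  (a + b * y^2) * Real.cosh (2*y) + c * y * Real.sinh (2*y) + (d + e * y^2) * Real.cosh y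
    + g * y * Real.sinh y + p + q * y^2

lemma hasDerivAt_sinh_two_mul (y : ℝ) :
    HasDerivAt (fun y : ℝ => Real.sinh (2*y)) (Real.cosh (2*y) * 2) y := by
  simpa using ((hasDerivAt_id y).const_mul 2).sinh

lemma hasDerivAt_cosh_two_mul (y : ℝ) :
    HasDerivAt (fun y : ℝ => Real.cosh (2*y)) (Real.sinh (2*y) * 2) y := by
  simpa using ((hasDerivAt_id y).const_mul 2).cosh

lemma hasDerivAt_hypOdd (a b c d e g p q y : ℝ) :
    HasDerivAt (hypOdd a b c d e g p q)
      (hypEven (2*a + c) (2*b) (2*b + 2*c) (d + g) e (2*e + g) p (3*q) y) y := by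
  have hy := hasDerivAt_id' y
  have h := (((((((hy.pow 2).const_mul b).const_add a).mul (hasDerivAt_sinh_two_mul y)).add
    ((hy.const_mul c).mul (hasDerivAt_cosh_two_mul y))).add
    ((((hy.pow 2).const_mul e).const_add d).mul (Real.hasDerivAt_sinh y))).add
    ((hy.const_mul g).mul (Real.hasDerivAt_cosh y))).add (hy.const_mul p) |>.add
    ((hy.pow 3).const_mul q)
  refine h.congr_deriv ?_
  simp only [hypEven, Pi.pow_apply]
  push_cast
  ring

lemma hasDerivAt_hypEven (a b c d e g p q y : ℝ) :
    HasDerivAt (hypEven a b c d e g p q)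
      (hypOdd (2*a + c) (2*b) (2*b + 2*c) (d + g) e (2*e + g) (2*q) 0 y) y := by
  have hy := hasDerivAt_id' y
  have h := (((((((hy.pow 2).const_mul b).const_add a).mul (hasDerivAt_cosh_two_mul y)).add
    ((hy.const_mul c).mul (hasDerivAt_sinh_two_mul y))).add
    ((((hy.pow 2).const_mul e).const_add d).mul (Real.hasDerivAt_cosh y))).add
    ((hy.const_mul g).mul (Real.hasDerivAt_sinh y))).add_const p |>.add
    ((hy.pow 2).const_mul q)
  refine h.congr_deriv ?_
  simp only [hypOdd, Pi.pow_apply]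
  push_cast
  ring

/-- Positivity of `hypOdd` from positivity of its second derivative. -/
lemma hypOdd_pos_of_second_deriv (a b c d e g p q : ℝ) (h0 : 0 ≤ 2*a + c + (d + g) + p)
    (h : ∀ y, 0 < y → 0 < hypOdd (2*(2*a + c) + (2*b + 2*c)) (2*(2*b)) (2*(2*b) + 2*(2*b + 2*c))
      (d + g + (2*e + g)) e (2*e + (2*e + g)) (2*(3*q)) 0 y) {y : ℝ} (hy : 0 < y) :
    0 < hypOdd a b c d e g p q y := by
  refine pos_of_hasDerivAt_pos (hasDerivAt_hypOdd a b c d e g p q) (by simp [hypOdd]) ?_ hy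
  intro z hz
  exact pos_of_hasDerivAt_pos (hasDerivAt_hypEven _ _ _ _ _ _ _ _)
    (by simpa [hypEven] using h0) h hz

lemma hypOdd_special_pos {y : ℝ} (hy : 0 < y) : 0 < hypOdd 1 (1/2) (-2) (-2) 2 2 0 (-1) y := by
  refine hypOdd_pos_of_second_deriv _ _ _ _ _ _ _ _ (by norm_num) (fun y hy => ?_) hy
  refine hypOdd_pos_of_second_deriv _ _ _ _ _ _ _ _ (by norm_num) (fun y hy => ?_) hy
  refine hypOdd_pos_of_second_deriv _ _ _ _ _ _ _ _ (by norm_num) (fun y hy => ?_) hy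
  refine hypOdd_pos_of_second_deriv _ _ _ _ _ _ _ _ (by norm_num) (fun y hy => ?_) hy
  norm_num [hypOdd]
  have h1 : 0 < Real.sinh y := Real.sinh_pos_iff.2 hy
  have h2 : 0 < Real.sinh (2*y) := Real.sinh_pos_iff.2 (by linarith)
  have h3 := Real.cosh_pos y
  have h4 := Real.cosh_pos (2*y)
  positivity

/-- The function `x coth x`. -/
def xcoth (x : ℝ) : ℝ := x * Real.cosh x / Real.sinh x

/-- The logarithmic derivative `x (x coth x)'`, in terms of `x coth x`. -/
def xcothD (x : ℝ) : ℝ := xcoth x - xcoth x ^ 2 + x^2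

/-- The slope `d xcothD / d xcoth`. -/
def xcothM (x : ℝ) : ℝ := 1 - 2 * xcoth x + 2 * x^2 / xcothD x

lemma xcothD_eq {x : ℝ} (hx : 0 < x) :
    xcothD x = x * (Real.sinh x * Real.cosh x - x) / Real.sinh x ^ 2 := by
  have hs : Real.sinh x ≠ 0 := (Real.sinh_pos_iff.2 hx).ne'
  have hc := Real.cosh_sq x
  unfold xcothD xcoth
  field_simp
  linear_combination (-x) * hc

lemma lt_sinh_mul_cosh {x : ℝ} (hx : 0 < x) : x < Real.sinh x * Real.cosh x := by
  have h1 := Real.self_lt_sinh_iff.2 hx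
  have h2 := Real.one_le_cosh x
  nlinarith

lemma xcothD_pos {x : ℝ} (hx : 0 < x) : 0 < xcothD x := by
  rw [xcothD_eq hx]
  have hs := Real.sinh_pos_iff.2 hx
  have := sub_pos.2 (lt_sinh_mul_cosh hx)
  positivity

lemma one_lt_xcoth {x : ℝ} (hx : 0 < x) : 1 < xcoth x := by
  have hs := Real.sinh_pos_iff.2 hx
  rw [xcoth, one_lt_div hs, ← sub_pos]
  refine pos_of_hasDerivAt_pos (f := fun x => x * Real.cosh x - Real.sinh x)
    (f' := fun x => x * Real.sinh x) (fun y => ?_) (by simp) (fun y hy => ?_) hx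
  · exact (((hasDerivAt_id' y).mul (Real.hasDerivAt_cosh y)).sub
      (Real.hasDerivAt_sinh y)).congr_deriv (by ring)
  · exact mul_pos hy (Real.sinh_pos_iff.2 hy)

lemma xcoth_lt_one_add {x : ℝ} (hx : 0 < x) : xcoth x < 1 + x := by
  have hs := Real.sinh_pos_iff.2 hx
  rw [xcoth, div_lt_iff₀ hs, ← sub_pos]
  refine pos_of_hasDerivAt_pos (f := fun x => (1 + x) * Real.sinh x - x * Real.cosh x)
    (f' := fun x => x * (Real.cosh x - Real.sinh x) + Real.sinh x)
    (fun y => ?_) (by simp) (fun y hy => ?_) hx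
  · exact ((((hasDerivAt_id' y).const_add 1).mul (Real.hasDerivAt_sinh y)).sub
      ((hasDerivAt_id' y).mul (Real.hasDerivAt_cosh y))).congr_deriv (by ring)
  · have h1 := Real.sinh_pos_iff.2 hy
    have h2 := sub_pos.2 (Real.sinh_lt_cosh y)
    positivity

lemma hasDerivAt_xcoth {x : ℝ} (hx : 0 < x) : HasDerivAt xcoth (xcothD x / x) x := by
  have hs : Real.sinh x ≠ 0 := (Real.sinh_pos_iff.2 hx).ne'
  refine (((hasDerivAt_id' x).mul (Real.hasDerivAt_cosh x)).div
    (Real.hasDerivAt_sinh x) hs).congr_deriv ?_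
  rw [xcothD_eq hx]
  have hc := Real.cosh_sq x
  simp only [Pi.mul_apply]
  field_simp
  linear_combination (-x) * hc

lemma hasDerivAt_xcothD {x : ℝ} (hx : 0 < x) :
    HasDerivAt xcothD (xcothD x * xcothM x / x) x := by
  have h := hasDerivAt_xcoth hx
  refine ((h.sub (h.pow 2)).add ((hasDerivAt_id' x).pow 2)).congr_deriv ?_
  have hD := (xcothD_pos hx).ne'
  unfold xcothM
  push_cast
  field_simp

lemma hasDerivAt_xcothM {x : ℝ} (hx : 0 < x) :
    HasDerivAt xcothM
      (-2 * xcothD x / x + 2 * x * (2 - xcothM x) / xcothD x) x := by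
  have hD := (xcothD_pos hx).ne'
  refine ((((hasDerivAt_xcoth hx).const_mul 2).const_sub 1).add
    ((((hasDerivAt_id' x).pow 2).const_mul 2).div (hasDerivAt_xcothD hx) hD)).congr_deriv ?_
  push_cast
  simp only [Pi.pow_apply]
  field_simp

lemma xcothD_cube_gt {x : ℝ} (hx : 0 < x) :
    x^2 * (1 + 2 * xcoth x) * xcothD x - 2 * x^4 < xcothD x ^ 3 := by
  have hs := Real.sinh_pos_iff.2 hx
  have hc := Real.cosh_sq x
  have hE := hypOdd_special_pos (y := 2*x) (by linarith)
  rw [← sub_pos]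
  have key : xcothD x ^ 3 - (x^2 * (1 + 2 * xcoth x) * xcothD x - 2 * x^4)
      = x^3 / Real.sinh x ^ 6 * (hypOdd 1 (1/2) (-2) (-2) 2 2 0 (-1) (2*x) / 8) := by
    rw [xcothD_eq hx, xcoth, hypOdd, Real.sinh_two_mul (2*x), Real.cosh_two_mul (2*x),
      Real.sinh_two_mul, Real.cosh_two_mul]
    generalize Real.sinh x = s at *
    generalize Real.cosh x = c at *
    field_simp
    have h3 : c^3 = c * (s^2+1) := by rw [← hc]; ring
    have h4 : c^4 = (s^2+1)^2 := by rw [← hc]; ring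
    ring_nf
    simp only [hc, h3, h4]
    ring
  rw [key]
  positivity

lemma strictAntiOn_xcothM : StrictAntiOn xcothM (Ioi 0) := by
  refine strictAntiOn_of_deriv_neg (convex_Ioi 0)
    (fun x hx => (hasDerivAt_xcothM hx).continuousAt.continuousWithinAt) fun x hx => ?_
  rw [interior_Ioi] at hx
  have hx : 0 < x := hx
  rw [(hasDerivAt_xcothM hx).deriv]
  have hD := xcothD_pos hx
  have h := xcothD_cube_gt hx
  have key : -2 * xcothD x / x + 2 * x * (2 - xcothM x) / xcothD x
      = 2 / (x * xcothD x ^ 2) *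
        (x^2 * (1 + 2 * xcoth x) * xcothD x - 2 * x^4 - xcothD x ^ 3) := by
    unfold xcothM
    field_simp
    ring
  rw [key]
  exact mul_neg_of_pos_of_neg (by positivity) (by linarith)

lemma tendsto_xcoth_zero : Tendsto xcoth (𝓝[>] 0) (𝓝 1) := by
  have h : Tendsto (fun x : ℝ => 1 + x) (𝓝[>] 0) (𝓝 1) := by
    have : Tendsto (fun x : ℝ => 1 + x) (𝓝 0) (𝓝 (1 + 0)) := tendsto_id.const_add 1
    rw [add_zero] at this
    exact this.mono_left nhdsWithin_le_nhds
  refine tendsto_of_tendsto_of_tendsto_of_le_of_le' tendsto_const_nhds h ?_ ?_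
  · filter_upwards [self_mem_nhdsWithin] with x hx using (one_lt_xcoth hx).le
  · filter_upwards [self_mem_nhdsWithin] with x hx using (xcoth_lt_one_add hx).le

lemma tendsto_xcothD_zero : Tendsto xcothD (𝓝[>] 0) (𝓝 0) := by
  have h : Tendsto (fun x : ℝ => x) (𝓝[>] 0) (𝓝 0) := nhdsWithin_le_nhds
  have h' := (tendsto_xcoth_zero.sub (tendsto_xcoth_zero.pow 2)).add (h.pow 2)
  norm_num at h'
  exact h'

lemma hasDerivAt_xcothD_sub (m : ℝ) {z : ℝ} (hz : 0 < z) :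
    HasDerivAt (fun z => xcothD z - m * xcoth z) (xcothD z / z * (xcothM z - m)) z :=
  ((hasDerivAt_xcothD hz).sub ((hasDerivAt_xcoth hz).const_mul m)).congr_deriv (by ring)

/-- `xcothD` lies above its tangent value at the origin, as a function of `xcoth`. -/
lemma xcothM_mul_lt {x : ℝ} (hx : 0 < x) : xcothM x * (xcoth x - 1) < xcothD x := by
  have hmono : StrictMonoOn (fun z => xcothD z - xcothM x * xcoth z) (Ioc 0 x) := by
    refine strictMonoOn_of_deriv_pos (convex_Ioc 0 x)
      (fun z hz => (hasDerivAt_xcothD_sub _ hz.1).continuousAt.continuousWithinAt) fun z hz => ?_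
    rw [interior_Ioc] at hz
    rw [(hasDerivAt_xcothD_sub _ hz.1).deriv]
    exact mul_pos (div_pos (xcothD_pos hz.1) hz.1)
      (sub_pos.2 (strictAntiOn_xcothM hz.1 hx hz.2))
  have hhalf := hmono (show x / 2 ∈ Ioc 0 x from ⟨by linarith, by linarith⟩)
    (right_mem_Ioc.2 hx) (by linarith)
  have hlim := tendsto_xcothD_zero.sub (tendsto_xcoth_zero.const_mul (xcothM x))
  have hle := le_of_tendsto hlim (b := xcothD (x/2) - xcothM x * xcoth (x/2)) (by
    filter_upwards [Ioo_mem_nhdsGT (half_pos hx)] with z hz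
    exact (hmono ⟨hz.1, by linarith [hz.2]⟩ ⟨by linarith, by linarith⟩ hz.2).le)
  simp only at hhalf
  linarith

/-- Strict concavity of `xcothD` as a function of `xcoth`. -/
lemma xcothD_sub_lt {x y : ℝ} (hx : 0 < x) (hxy : x < y) :
    xcothD y - xcothD x < xcothM x * (xcoth y - xcoth x) := by
  have hanti : StrictAntiOn (fun z => xcothD z - xcothM x * xcoth z) (Ici x) := by
    refine strictAntiOn_of_deriv_neg (convex_Ici x)
      (fun z hz => (hasDerivAt_xcothD_sub _ (hx.trans_le hz)).continuousAt.continuousWithinAt)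
      fun z hz => ?_
    rw [interior_Ici] at hz
    have hz0 : 0 < z := hx.trans hz
    rw [(hasDerivAt_xcothD_sub _ hz0).deriv]
    exact mul_neg_of_pos_of_neg (div_pos (xcothD_pos hz0) hz0)
      (sub_neg.2 (strictAntiOn_xcothM hx hz0 hz))
  have := hanti self_mem_Ici hxy.le hxy
  simp only at this
  linarith

/-- The difference `k t coth (k t) - t coth t`. -/
def diffB (k t : ℝ) : ℝ := xcoth (k*t) - xcoth t

/-- `t² - (t coth t - 1)²`. -/
def quadA (t : ℝ) : ℝ := t^2 - (xcoth t - 1)^2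

/-- The weight `sinh² t / t²`. -/
def wgt (t : ℝ) : ℝ := Real.sinh t ^ 2 / t^2

lemma hasDerivAt_diffB {k t : ℝ} (hk : 0 < k) (ht : 0 < t) :
    HasDerivAt (diffB k) ((xcothD (k*t) - xcothD t) / t) t := by
  have h1 : HasDerivAt (fun t => k * t) k t := by simpa using (hasDerivAt_id t).const_mul k
  refine (((hasDerivAt_xcoth (mul_pos hk ht)).comp t h1).sub
    (hasDerivAt_xcoth ht)).congr_deriv ?_
  field_simp

lemma hasDerivAt_quadA {t : ℝ} (ht : 0 < t) :
    HasDerivAt quadA (xcothD t * (1 + xcothM t) / t) t := by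
  have hD := (xcothD_pos ht).ne'
  refine (((hasDerivAt_id' t).pow 2).sub
    (((hasDerivAt_xcoth ht).sub_const 1).pow 2)).congr_deriv ?_
  unfold xcothM
  push_cast
  field_simp
  ring

lemma quadA_eq (t : ℝ) : quadA t = xcoth t + xcothD t - 1 := by
  unfold quadA xcothD
  ring

lemma deriv_combination_pos {k t : ℝ} (hk : 1 < k) (ht : 0 < t)
    (h0 : (k^2 - 1) * quadA t = 4 * diffB k t) :
    0 < (k^2 - 1) * (xcothD t * (1 + xcothM t) / t)
      - 4 * ((xcothD (k*t) - xcothD t) / t) := by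
  have h1 := xcothD_sub_lt ht (show t < k*t by nlinarith)
  have h2 := xcothM_mul_lt ht
  rw [quadA_eq, diffB] at h0
  have hk2 : 0 < k^2 - 1 := by nlinarith
  have h3 := mul_pos hk2 (sub_pos.2 h2)
  have : (k^2 - 1) * (xcothD t * (1 + xcothM t) / t) - 4 * ((xcothD (k*t) - xcothD t) / t)
      = ((k^2 - 1) * (xcothD t * (1 + xcothM t)) - 4 * (xcothD (k*t) - xcothD t)) / t := by ring
  rw [this]
  refine div_pos ?_ ht
  linear_combination h3 + 4 * h1 - xcothM t * h0

lemma Rsq_exp_neg (t : ℝ) : Rsq (Real.exp (-t)) = (1 - Real.exp (-t)^2) / (2*t) := by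
  simp [Rsq]

lemma div_exp_neg_sq (a t : ℝ) :
    a / Real.exp (-t)^2 = a * (Real.cosh t + Real.sinh t)^2 := by
  rw [Real.cosh_add_sinh, Real.exp_neg, inv_pow, div_inv_eq_mul]

lemma Tfun_exp_neg {k t : ℝ} (hk : 0 < k) (ht : 0 < t) :
    Tfun (Real.exp (-t)) k = 2 + 2 * (wgt t * diffB k t) := by
  have hs : Real.sinh t ≠ 0 := (Real.sinh_pos_iff.2 ht).ne'
  have hsk : Real.sinh (k*t) ≠ 0 := (Real.sinh_pos_iff.2 (mul_pos hk ht)).ne'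
  have ho : om (Real.exp (-t)) k = k * t := by simp [om]
  rw [Tfun, ho, Rsq_exp_neg, cothR, wgt, diffB, xcoth, xcoth]
  have he : Real.exp (-t) = Real.cosh t - Real.sinh t := (Real.cosh_sub_sinh t).symm
  have hc := Real.cosh_sq t
  rw [div_exp_neg_sq, div_exp_neg_sq, he]
  generalize Real.sinh t = s at *
  generalize Real.cosh t = c at *
  generalize Real.sinh (k*t) = s' at *
  generalize Real.cosh (k*t) = c' at *
  field_simp
  have h4 : c^4 = (s^2+1)^2 := by rw [← hc]; ring
  ring_nf
  simp only [hc, h4]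
  ring

lemma Dfun_exp_neg (k : ℝ) {t : ℝ} (ht : 0 < t) :
    Dfun (Real.exp (-t)) k = (k^2 - 1) * (wgt t * quadA t) := by
  have hs : Real.sinh t ≠ 0 := (Real.sinh_pos_iff.2 ht).ne'
  rw [Dfun, Rsq_exp_neg, wgt, quadA, xcoth]
  have he : Real.exp (-t) = Real.cosh t - Real.sinh t := (Real.cosh_sub_sinh t).symm
  have hc := Real.cosh_sq t
  rw [div_exp_neg_sq, he]
  generalize Real.sinh t = s at *
  generalize Real.cosh t = c at *
  field_simp
  have h3 : c^3 = c * (s^2+1) := by rw [← hc]; ring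
  have h4 : c^4 = (s^2+1)^2 := by rw [← hc]; ring
  have h5 : c^5 = c * (s^2+1)^2 := by rw [← hc]; ring
  have h6 : c^6 = (s^2+1)^3 := by rw [← hc]; ring
  ring_nf
  simp only [hc, h3, h4, h5, h6]
  ring

lemma one_lt_cothR {x : ℝ} (hx : 0 < x) : 1 < cothR x :=
  (one_lt_div (Real.sinh_pos_iff.2 hx)).2 (Real.sinh_lt_cosh x)

lemma quadA_pos {t : ℝ} (ht : 0 < t) : 0 < quadA t := by
  have h1 := one_lt_xcoth ht
  have h2 := xcoth_lt_one_add ht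
  unfold quadA
  nlinarith

lemma wgt_pos {t : ℝ} (ht : 0 < t) : 0 < wgt t :=
  div_pos (pow_pos (Real.sinh_pos_iff.2 ht) 2) (pow_pos ht 2)

lemma discriminant_pos {k t : ℝ} (hk : 1 < k) (ht : 0 < t) :
    0 < Tfun (Real.exp (-t)) k ^ 2 - 4 * Dfun (Real.exp (-t)) k := by
  have hD := Dfun_exp_neg k ht
  have hk2 : 0 < k^2 - 1 := by nlinarith
  have ho : om (Real.exp (-t)) k = k * t := by simp [om]
  have hκ := one_lt_cothR (mul_pos (zero_lt_one.trans hk) ht)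
  have hw := mul_pos (wgt_pos ht) (quadA_pos ht)
  rw [Dfun, mul_comm] at hD
  have hab := (mul_left_cancel₀ hk2.ne' hD).symm ▸ hw
  rw [Tfun, Dfun, ho]
  generalize Rsq (Real.exp (-t)) = r at *
  generalize Real.exp (-t) = l at *
  generalize cothR (k*t) = κ at *
  have h1 : 0 < k^2 * (κ^2 - 1) := by
    have : 0 < κ^2 - 1 := by nlinarith
    positivity
  have h2 := mul_pos hab h1
  have h3 := sq_nonneg ((r/l^2 - 1 - (1 - r)) * (k*κ) - (r/l^2 - 1 + (1 - r)))
  linear_combination h3 + 4 * h2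

lemma hasDerivAt_wgt {t : ℝ} (ht : 0 < t) : ∃ w', HasDerivAt wgt w' t :=
  ⟨_, ((Real.hasDerivAt_sinh t).pow 2).div ((hasDerivAt_id' t).pow 2) (pow_pos ht 2).ne'⟩

/-- Derivative of the smaller root of `x² - T x + D` at a parameter where this root is `2`. -/
lemma hasDerivAt_smaller_root {T D : ℝ → ℝ} {T' D' t : ℝ} (hT : HasDerivAt T T' t)
    (hD : HasDerivAt D D' t) (hpos : 0 < T t ^ 2 - 4 * D t)
    (h0 : (T t - √(T t ^ 2 - 4 * D t)) / 2 - 2 = 0) :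
    HasDerivAt (fun s => (T s - √(T s ^ 2 - 4 * D s)) / 2 - 2) ((D' - 2 * T') / (T t - 4)) t := by
  have hs : √(T t ^ 2 - 4 * D t) = T t - 4 := by linarith
  have hne : T t - 4 ≠ 0 := hs ▸ (Real.sqrt_pos.2 hpos).ne'
  refine (((hT.sub (((hT.pow 2).sub (hD.const_mul 4)).sqrt hpos.ne')).div_const 2).sub_const
    2).congr_deriv ?_
  simp only [Pi.sub_apply, Pi.pow_apply]
  rw [hs]
  push_cast
  field_simp
  ring

/-- In the variable `t = -log λ`, the eigenvalue `μ₁` crosses zero increasingly. -/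
lemma hasDerivAt_mu1_exp_neg {k t : ℝ} (hk : 1 < k) (ht : 0 < t)
    (h0 : mu1 (Real.exp (-t)) k = 0) :
    ∃ d, 0 < d ∧ HasDerivAt (fun s => mu1 (Real.exp (-s)) k) d t := by
  have hk0 := zero_lt_one.trans hk
  have hpos := discriminant_pos hk ht
  rw [mu1] at h0
  have hroot : √(Tfun (Real.exp (-t)) k ^ 2 - 4 * Dfun (Real.exp (-t)) k)
      = Tfun (Real.exp (-t)) k - 4 := by linarith
  have hT4 := hroot ▸ Real.sqrt_pos.2 hpos
  have hsq := Real.sq_sqrt hpos.le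
  rw [hroot] at hsq
  obtain ⟨w', hw⟩ := hasDerivAt_wgt ht
  have hT : HasDerivAt (fun s => Tfun (Real.exp (-s)) k) _ t :=
    (((hw.mul (hasDerivAt_diffB hk0 ht)).const_mul 2).const_add 2).congr_of_eventuallyEq (by
      filter_upwards [lt_mem_nhds ht] with s hs using Tfun_exp_neg hk0 hs)
  have hD : HasDerivAt (fun s => Dfun (Real.exp (-s)) k) _ t :=
    ((hw.mul (hasDerivAt_quadA ht)).const_mul (k^2 - 1)).congr_of_eventuallyEq (by
      filter_upwards [lt_mem_nhds ht] with s hs using Dfun_exp_neg k hs)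
  refine ⟨_, ?_, hasDerivAt_smaller_root hT hD hpos h0⟩
  refine div_pos ?_ hT4
  rw [Tfun_exp_neg hk0 ht, Dfun_exp_neg k ht] at hsq
  have hG : (k^2 - 1) * quadA t = 4 * diffB k t := by
    refine mul_left_cancel₀ (wgt_pos ht).ne' ?_
    linear_combination hsq / 4
  have h := mul_pos (wgt_pos ht) (deriv_combination_pos hk ht hG)
  linear_combination h - w' * hG

theorem mu1_deriv_neg_at_zero :
    ∀ k : ℝ, 1 < k → ∀ l₀ ∈ Ioo (0:ℝ) 1, mu1 l₀ k = 0 →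
      deriv (fun l => mu1 l k) l₀ < 0 := by
  rintro k hk l ⟨hl0, hl1⟩ h0
  have ht : 0 < -Real.log l := neg_pos.2 (Real.log_neg hl0 hl1)
  have hexp : ∀ x : ℝ, 0 < x → Real.exp (- -Real.log x) = x := fun x hx => by
    rw [neg_neg, Real.exp_log hx]
  obtain ⟨d, hd, hderiv⟩ := hasDerivAt_mu1_exp_neg hk ht (by rwa [hexp l hl0])
  have hcomp : HasDerivAt (fun x => mu1 x k) (d * -l⁻¹) l :=
    (hderiv.comp l (Real.hasDerivAt_log hl0.ne').neg).congr_of_eventuallyEq (by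
      filter_upwards [lt_mem_nhds hl0] with x hx
      simp only [Function.comp_apply, Pi.neg_apply, hexp x hx])
  rw [hcomp.deriv]
  exact mul_neg_of_pos_of_neg hd (neg_neg_of_pos (inv_pos.2 hl0))
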